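/- For any nonzero x ∈ ℝ^d and any v ∈ ℝ^d, E_{w ∼ N(0, I_d)}[(vᵀw) · 1_{wᵀx ≥ 0}] = (vᵀx)/(‖x‖ √(2π)). -/

import Mathlib

open MeasureTheory ProbabilityTheory

lemma aux_1d : ∫ t : ℝ, (if 0 ≤ t then t else 0) ∂(gaussianReal 0 1)
    = 1 / Real.sqrt (2 * Real.pi) := by
  rw [integral_gaussianReal_eq_integral_smul one_ne_zero]
  have h := integral_rpow_mul_exp_neg_mul_rpow (p := 2) (q := 1) (b := 1 / 2)
    (by norm_num) (by norm_num) (by norm_num)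
  have h1 : (fun t : ℝ => gaussianPDFReal 0 1 t • (if 0 ≤ t then t else 0))
      = Set.indicator (Set.Ioi 0) (fun t : ℝ => (Real.sqrt (2 * Real.pi))⁻¹ *
        (t ^ (1 : ℝ) * Real.exp (-(1 / 2) * t ^ (2 : ℝ)))) := by
    funext t
    rcases lt_trichotomy t 0 with ht | ht | ht
    · simp [ht.not_ge, ht.le]
    · simp [ht]
    · simp only [gaussianPDFReal, Set.indicator, Set.mem_Ioi, ht, ht.le, if_true, smul_eq_mul,
        Real.rpow_one, Real.rpow_two, NNReal.coe_one, mul_one, sub_zero]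
      rw [show -t ^ 2 / 2 = -(1 / 2) * t ^ 2 by ring]
      ring
  rw [h1, integral_indicator measurableSet_Ioi, integral_const_mul, h]
  have h2 : (-(1 + 1) / 2 : ℝ) = -1 := by norm_num
  have h3 : ((1 + 1) / 2 : ℝ) = 1 := by norm_num
  rw [h2, h3, Real.Gamma_one, Real.rpow_neg_one]
  norm_num

lemma aux_E {E : Type*} [NormedAddCommGroup E] [InnerProductSpace ℝ E] [FiniteDimensional ℝ E]
    [MeasurableSpace E] [BorelSpace E] (e v : E) (he : ‖e‖ = 1) :
    ∫ w, (if 0 ≤ inner ℝ e w then inner ℝ v w else 0) ∂(stdGaussian E)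
      = inner ℝ v e / Real.sqrt (2 * Real.pi) := by
  set F : E → ℝ := fun w => if 0 ≤ inner ℝ e w then inner ℝ v w else 0 with hF
  have hs : MeasurableSet {w : E | 0 ≤ inner ℝ e w} :=
    measurableSet_le measurable_const (by fun_prop)
  have hFm : Measurable F := Measurable.ite hs (by fun_prop) measurable_const
  have hFi : Integrable F (stdGaussian E) := by
    have h := (IsGaussian.integrable_dual (stdGaussian E) (innerSL ℝ v)).indicator hs
    refine h.congr (ae_of_all _ fun w => ?_)
    simp [F, Set.indicator]
  set R := (Submodule.span ℝ {e}).reflection with hR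
  have hmap : (stdGaussian E).map R = stdGaussian E := stdGaussian_map R
  have hRm : Measurable R := R.continuous.measurable
  have hRi : Integrable (fun w => F (R w)) (stdGaussian E) := by
    rw [← hmap] at hFi
    exact hFi.comp_measurable hRm
  have hRint : ∫ w, F (R w) ∂(stdGaussian E) = ∫ w, F w ∂(stdGaussian E) := by
    conv_rhs => rw [← hmap]
    rw [integral_map hRm.aemeasurable hFm.aestronglyMeasurable]
  have hRw : ∀ w, R w = (2 * inner ℝ e w) • e - w := by
    intro w
    rw [hR, Submodule.reflection_apply, Submodule.starProjection_unit_singleton ℝ he, mul_smul,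
      two_smul, two_smul]
  have hee : inner ℝ e e = (1 : ℝ) := by rw [real_inner_self_eq_norm_sq, he]; norm_num
  have hsum : ∀ w, F w + F (R w)
      = 2 * inner ℝ v e * (fun t : ℝ => if 0 ≤ t then t else 0) (innerSL ℝ e w) := by
    intro w
    have h1 : inner ℝ e (R w) = inner ℝ e w := by
      rw [hRw, inner_sub_right, inner_smul_right, hee]; ring
    have h2 : inner ℝ v (R w) = 2 * inner ℝ e w * inner ℝ v e - inner ℝ v w := by
      rw [hRw, inner_sub_right, inner_smul_right]
    rw [innerSL_apply_apply]
    simp only [F, h1, h2]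
    by_cases hc : 0 ≤ inner ℝ e w
    · rw [if_pos hc, if_pos hc, if_pos hc]; ring
    · rw [if_neg hc, if_neg hc, if_neg hc]; ring
  have hm : (stdGaussian E).map (innerSL ℝ e) = gaussianReal 0 1 := by
    rw [IsGaussian.map_eq_gaussianReal, variance_dual_stdGaussian,
      integral_strongDual_stdGaussian, innerSL_apply_norm, he]
    simp
  have hfin : ∫ w, (F w + F (R w)) ∂(stdGaussian E)
      = 2 * inner ℝ v e * (1 / Real.sqrt (2 * Real.pi)) := by
    simp_rw [hsum]
    rw [integral_const_mul, ← aux_1d, ← hm, integral_map (by fun_prop)]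
    exact (Measurable.ite measurableSet_Ici measurable_id measurable_const).aestronglyMeasurable
  rw [integral_add hFi hRi, hRint] at hfin
  rw [div_eq_mul_one_div]
  linarith

/-- For nonzero x and any v in ℝ^d,
    E_{w ∼ N(0,I_d)}[(vᵀw) 1_{wᵀx ≥ 0}] = (vᵀx)/(‖x‖√(2π)). -/
theorem stmt_3 (d : ℕ) (x v : Fin d → ℝ) (hx : x ≠ 0) :
    ∫ w : Fin d → ℝ, (if 0 ≤ ∑ k, w k * x k then ∑ k, v k * w k else 0)
      ∂(Measure.pi fun _ : Fin d => gaussianReal 0 1)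
    = (∑ k, v k * x k) / (Real.sqrt (∑ k, x k ^ 2) * Real.sqrt (2 * Real.pi)) := by
  set X : EuclideanSpace ℝ (Fin d) := WithLp.toLp 2 x with hX
  set V : EuclideanSpace ℝ (Fin d) := WithLp.toLp 2 v with hV
  have hX0 : X ≠ 0 := by
    intro h
    exact hx ((WithLp.toLp_eq_zero 2).1 h)
  have hn : 0 < ‖X‖ := norm_pos_iff.2 hX0
  have hnorm : ‖X‖ = Real.sqrt (∑ k, x k ^ 2) := by
    rw [EuclideanSpace.norm_eq]; simp [hX]
  have hin : ∀ a b : Fin d → ℝ, inner ℝ (WithLp.toLp 2 a : EuclideanSpace ℝ (Fin d))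
      (WithLp.toLp 2 b) = ∑ k, a k * b k := by
    intro a b
    simp [PiLp.inner_apply, mul_comm]
  have h := aux_E (‖X‖⁻¹ • X) V (by
    rw [norm_smul, norm_inv, norm_norm, inv_mul_cancel₀ hn.ne'])
  have hme : Measurable (fun w : EuclideanSpace ℝ (Fin d) =>
      if 0 ≤ inner ℝ (‖X‖⁻¹ • X) w then inner ℝ V w else 0) :=
    Measurable.ite (measurableSet_le measurable_const (by fun_prop)) (by fun_prop)
      measurable_const
  rw [← map_pi_eq_stdGaussian, integral_map (by fun_prop) hme.aestronglyMeasurable] at h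
  have hc : ∀ a : ℝ, 0 ≤ ‖X‖⁻¹ * a ↔ 0 ≤ a := fun a => mul_nonneg_iff_of_pos_left (inv_pos.2 hn)
  simp only [real_inner_smul_left, real_inner_smul_right, hc] at h
  simp only [hX, hV, hin] at h
  rw [← hX, hnorm] at h
  simp_rw [mul_comm (x _)] at h
  rw [h, div_mul_eq_div_div]
  congr 1
  rw [div_eq_inv_mul]
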